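/- For every finite set Λ ⊆ ℤ^d and every ν ∈ Λ \ {0}, the off-diagonal row sum of the Gram matrix satisfies Σ_{μ ∈ Λ, μ ≠ ν} |G_{νμ}| ≤ (2a₀ + ρ/(2π²))·β + β². -/

import Mathlib

open Finset MeasureTheory

noncomputable def fourF (d : ℕ) (ν : Fin d → ℤ) (x : Fin d → ℝ) : ℂ :=
  Complex.exp (2 * (Real.pi : ℂ) * Complex.I * ∑ j, (ν j : ℂ) * (x j : ℂ))

noncomputable def pdv (d : ℕ) (k : Fin d) (f : (Fin d → ℝ) → ℂ) : (Fin d → ℝ) → ℂ :=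
  fun x => fderiv ℝ f x (Pi.single k 1)

noncomputable def lapl (d : ℕ) (f : (Fin d → ℝ) → ℂ) : (Fin d → ℝ) → ℂ :=
  fun x => ∑ k, pdv d k (pdv d k f) x

noncomputable def sqL2 (d : ℕ) (f : (Fin d → ℝ) → ℂ) : ℝ :=
  ∫ x in Set.Icc (0 : Fin d → ℝ) 1, ‖f x‖ ^ 2

noncomputable def sqH2 (d : ℕ) (f : (Fin d → ℝ) → ℂ) : ℝ :=
  sqL2 d f + (∑ k : Fin d, sqL2 d (pdv d k f)) +
    ∑ k : Fin d, ∑ l : Fin d, sqL2 d (pdv d k (pdv d l f))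

noncomputable def enorm2Z (d : ℕ) (ν : Fin d → ℤ) : ℝ := ∑ j, ((ν j : ℝ)) ^ 2

noncomputable def dotZR (d : ℕ) (τ ν : Fin d → ℤ) : ℝ := ∑ j, (τ j : ℝ) * (ν j : ℝ)

noncomputable def Lop (d : ℕ) (a : (Fin d → ℝ) → ℂ) (ρ : ℝ) (u : (Fin d → ℝ) → ℂ) :
    (Fin d → ℝ) → ℂ :=
  fun x => -(∑ k, pdv d k (fun y => a y * pdv d k u y) x) + (ρ : ℂ) * u x

noncomputable def GramM (d : ℕ) (a : (Fin d → ℝ) → ℂ) (ρ : ℝ)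
    (Ψ : (Fin d → ℤ) → (Fin d → ℝ) → ℂ) (ν μ : Fin d → ℤ) : ℂ :=
  ∫ x in Set.Icc (0 : Fin d → ℝ) 1,
    Lop d a ρ (Ψ ν) x * (starRingEnd ℂ) (Lop d a ρ (Ψ μ) x)

/-- The coefficients of `Lop` applied to the rescaled Fourier function at `ν`, where `α` are the
Fourier coefficients of the diffusion coefficient. -/
noncomputable def opCoeff (d : ℕ) (α : (Fin d → ℤ) → ℂ) (ρ s : ℝ) (ν τ : Fin d → ℤ) : ℂ :=
  s * (4 * (Real.pi : ℂ) ^ 2 * α τ * dotZR d ν (τ + ν) + if τ = 0 then (ρ : ℂ) else 0)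

lemma fourF_add (d : ℕ) (τ ν : Fin d → ℤ) (x : Fin d → ℝ) :
    fourF d (τ + ν) x = fourF d τ x * fourF d ν x := by
  simp only [fourF, ← Complex.exp_add, Pi.add_apply, Int.cast_add, add_mul,
    Finset.sum_add_distrib, mul_add]

lemma conj_fourF (d : ℕ) (ν : Fin d → ℤ) (x : Fin d → ℝ) :
    (starRingEnd ℂ) (fourF d ν x) = fourF d (-ν) x := by
  simp [fourF, ← Complex.exp_conj, map_sum, Complex.conj_ofNat]

lemma fourF_zero (d : ℕ) (x : Fin d → ℝ) : fourF d 0 x = 1 := by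
  simp [fourF]

lemma continuous_fourF (d : ℕ) (ν : Fin d → ℤ) : Continuous (fourF d ν) := by
  unfold fourF
  fun_prop

lemma differentiable_fourF (d : ℕ) (ν : Fin d → ℤ) : Differentiable ℝ (fourF d ν) := by
  unfold fourF
  have h : ∀ j : Fin d, Differentiable ℝ (fun x : Fin d → ℝ => ((x j : ℝ) : ℂ)) := fun j =>
    Complex.ofRealCLM.differentiable.comp (differentiable_apply j)
  fun_prop

lemma pdv_fourF (d : ℕ) (k : Fin d) (ν : Fin d → ℤ) (x : Fin d → ℝ) :
    pdv d k (fourF d ν) x = 2 * Real.pi * Complex.I * ν k * fourF d ν x := by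
  have h : ∀ j : Fin d, HasFDerivAt (fun x : Fin d → ℝ => ((x j : ℝ) : ℂ))
      (Complex.ofRealCLM.comp (ContinuousLinearMap.proj j)) x := fun j =>
    (Complex.ofRealCLM.comp (ContinuousLinearMap.proj (R := ℝ) (φ := fun _ : Fin d => ℝ) j)).hasFDerivAt
  have h2 := ((HasFDerivAt.fun_sum (u := Finset.univ)
    (fun j _ => (h j).const_mul ((ν j : ℤ) : ℂ))).const_mul
      (2 * (Real.pi : ℂ) * Complex.I)).cexp
  have h3 : HasFDerivAt (fourF d ν) _ x := h2
  rw [pdv, h3.fderiv]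
  simp [fourF, Pi.single_apply, apply_ite]
  ring

lemma pdv_sum_fourF (d : ℕ) (k : Fin d) (s : Finset (Fin d → ℤ)) (c : (Fin d → ℤ) → ℂ)
    (n : (Fin d → ℤ) → Fin d → ℤ) (x : Fin d → ℝ) :
    pdv d k (fun y => ∑ i ∈ s, c i * fourF d (n i) y) x =
      ∑ i ∈ s, c i * (2 * Real.pi * Complex.I * n i k) * fourF d (n i) x := by
  have h : HasFDerivAt (fun y => ∑ i ∈ s, c i * fourF d (n i) y) _ x :=
    HasFDerivAt.fun_sum (u := s)
      (fun i _ => ((differentiable_fourF d (n i) x).hasFDerivAt).const_mul (c i))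
  rw [pdv, h.fderiv]
  simp only [_root_.sum_apply, _root_.smul_apply, smul_eq_mul]
  refine Finset.sum_congr rfl fun i _ => ?_
  have := pdv_fourF d k (n i) x
  rw [pdv] at this
  rw [this]
  ring

lemma pdv_const_mul_fourF (d : ℕ) (k : Fin d) (s : ℂ) (ν : Fin d → ℤ) (x : Fin d → ℝ) :
    pdv d k (fun y => s * fourF d ν y) x =
      s * (2 * Real.pi * Complex.I * ν k) * fourF d ν x := by
  simpa using pdv_sum_fourF d k {0} (fun _ => s) (fun _ => ν) x

lemma Lop_fourF (d : ℕ) (S : Finset (Fin d → ℤ)) (hS : 0 ∈ S) (α : (Fin d → ℤ) → ℂ)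
    (ρ s : ℝ) (ν : Fin d → ℤ) (x : Fin d → ℝ) :
    Lop d (fun x => ∑ τ ∈ S, α τ * fourF d τ x) ρ (fun y => (s : ℂ) * fourF d ν y) x =
      ∑ τ ∈ S, opCoeff d α ρ s ν τ * fourF d (τ + ν) x := by
  have h1 : ∀ k : Fin d, (fun y => (∑ τ ∈ S, α τ * fourF d τ y) *
      pdv d k (fun y => (s : ℂ) * fourF d ν y) y) =
      fun y => ∑ τ ∈ S, (α τ * (s * (2 * Real.pi * Complex.I * ν k))) * fourF d (τ + ν) y := by
    intro k
    funext y
    rw [pdv_const_mul_fourF, Finset.sum_mul]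
    refine Finset.sum_congr rfl fun τ _ => ?_
    rw [fourF_add]
    ring
  simp only [Lop, h1, pdv_sum_fourF d _ S _ (fun τ => τ + ν)]
  have h2 : (ρ : ℂ) * (s * fourF d ν x) =
      ∑ τ ∈ S, (if τ = 0 then (ρ : ℂ) * s else 0) * fourF d (τ + ν) x := by
    simp [ite_mul, hS, mul_assoc]
  rw [h2, Finset.sum_comm, ← Finset.sum_neg_distrib, ← Finset.sum_add_distrib]
  refine Finset.sum_congr rfl fun τ _ => ?_
  have h3 : ∑ k, α τ * (s * (2 * Real.pi * Complex.I * ν k)) *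
      (2 * Real.pi * Complex.I * ((τ + ν) k : ℤ)) * fourF d (τ + ν) x =
      -(s * (4 * (Real.pi : ℂ) ^ 2 * α τ * dotZR d ν (τ + ν))) * fourF d (τ + ν) x := by
    simp only [dotZR, Complex.ofReal_sum, Complex.ofReal_mul, Complex.ofReal_intCast,
      Finset.mul_sum, Finset.sum_mul, ← Finset.sum_neg_distrib]
    refine Finset.sum_congr rfl fun k _ => ?_
    linear_combination (4 * α τ * s * (Real.pi : ℂ) ^ 2 * ν k * ((τ + ν) k : ℤ) *
      fourF d (τ + ν) x) * Complex.I_sq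
  rw [h3, opCoeff]
  split_ifs <;> ring

lemma integral_fourF (d : ℕ) (ν : Fin d → ℤ) :
    ∫ x in Set.Icc (0 : Fin d → ℝ) 1, fourF d ν x = if ν = 0 then 1 else 0 := by
  have h1 : ∀ n : ℤ, ∫ t in Set.Icc (0 : ℝ) 1,
      Complex.exp (2 * (Real.pi : ℂ) * Complex.I * (n * (t : ℂ))) = if n = 0 then 1 else 0 := by
    intro n
    rw [integral_Icc_eq_integral_Ioc, ← intervalIntegral.integral_of_le zero_le_one]
    split_ifs with hn
    · simp [hn]
    · have hc : 2 * (Real.pi : ℂ) * Complex.I * n ≠ 0 := by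
        simp [hn, Real.pi_ne_zero]
      simp only [← mul_assoc]
      rw [integral_exp_mul_complex hc]
      have := Complex.exp_int_mul_two_pi_mul_I n
      rw [show 2 * (Real.pi : ℂ) * Complex.I * n * (1 : ℝ) = n * (2 * Real.pi * Complex.I) by
        push_cast; ring, this]
      simp
  have h2 : ∀ x, fourF d ν x =
      ∏ j, Complex.exp (2 * (Real.pi : ℂ) * Complex.I * (ν j * (x j : ℂ))) := by
    intro x
    rw [fourF, Finset.mul_sum, Complex.exp_sum]
  simp only [h2]
  rw [← Set.pi_univ_Icc, volume_pi, Measure.restrict_pi_pi]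
  simp only [Pi.zero_apply, Pi.one_apply]
  rw [integral_fintype_prod_eq_prod (𝕜 := ℂ) (fun j (t : ℝ) =>
    Complex.exp (2 * (Real.pi : ℂ) * Complex.I * (ν j * (t : ℂ))))]
  simp only [h1]
  split_ifs with h
  · simp [h]
  · obtain ⟨j, hj⟩ := Function.ne_iff.mp h
    exact Finset.prod_eq_zero (Finset.mem_univ j) (if_neg hj)

lemma integral_sum_fourF_mul_conj (d : ℕ) (S : Finset (Fin d → ℤ))
    (c e : (Fin d → ℤ) → ℂ) (ν μ : Fin d → ℤ) :
    ∫ x in Set.Icc (0 : Fin d → ℝ) 1, (∑ τ ∈ S, c τ * fourF d (τ + ν) x) *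
        (starRingEnd ℂ) (∑ τ ∈ S, e τ * fourF d (τ + μ) x) =
      ∑ τ ∈ S, ∑ σ ∈ S,
        if μ = ν + τ - σ then c τ * (starRingEnd ℂ) (e σ) else 0 := by
  have h : ∀ x, (∑ τ ∈ S, c τ * fourF d (τ + ν) x) *
        (starRingEnd ℂ) (∑ τ ∈ S, e τ * fourF d (τ + μ) x) =
      ∑ τ ∈ S, ∑ σ ∈ S,
        c τ * (starRingEnd ℂ) (e σ) * fourF d (τ + ν + -(σ + μ)) x := by
    intro x
    rw [map_sum, Finset.sum_mul_sum]
    refine Finset.sum_congr rfl fun τ _ => Finset.sum_congr rfl fun σ _ => ?_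
    rw [map_mul, conj_fourF, fourF_add d (τ + ν)]
    ring
  have hi : ∀ (z : ℂ) (κ : Fin d → ℤ),
      IntegrableOn (fun x => z * fourF d κ x) (Set.Icc 0 1) := fun z κ =>
    (continuous_const.mul (continuous_fourF d κ)).continuousOn.integrableOn_compact isCompact_Icc
  simp only [h]
  rw [integral_finsetSum _ fun τ _ => integrable_finsetSum _ fun σ _ => hi _ _]
  refine Finset.sum_congr rfl fun τ _ => ?_
  rw [integral_finsetSum _ fun σ _ => hi _ _]
  refine Finset.sum_congr rfl fun σ _ => ?_
  rw [integral_const_mul, integral_fourF]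
  have : τ + ν + -(σ + μ) = 0 ↔ μ = ν + τ - σ := by
    constructor <;> intro h
    · rw [← sub_eq_zero, ← neg_eq_zero, ← h]; abel
    · rw [h]; abel
  simp only [this, mul_ite, mul_one, mul_zero]

lemma sum_offDiag_norm_le {G : Type*} [AddCommGroup G] [DecidableEq G] (S Λ : Finset G)
    (f : G → G → G → ℂ) (b : G → ℝ) (ν : G) (hb : ∀ τ ∈ S, 0 ≤ b τ)
    (hf : ∀ μ, ∀ τ ∈ S, ∀ σ ∈ S, ‖f μ τ σ‖ ≤ b τ * b σ) :
    ∑ μ ∈ Λ.erase ν, ‖∑ τ ∈ S, ∑ σ ∈ S, if μ = ν + τ - σ then f μ τ σ else 0‖ ≤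
      (∑ τ ∈ S, b τ) ^ 2 - ∑ τ ∈ S, b τ ^ 2 := by
  calc _ ≤ ∑ μ ∈ Λ.erase ν, ∑ τ ∈ S, ∑ σ ∈ S, if μ = ν + τ - σ then b τ * b σ else 0 := by
        refine Finset.sum_le_sum fun μ _ => (norm_sum_le _ _).trans <|
          Finset.sum_le_sum fun τ hτ => (norm_sum_le _ _).trans <|
          Finset.sum_le_sum fun σ hσ => ?_
        split_ifs
        · exact hf μ τ hτ σ hσ
        · simp
    _ = ∑ τ ∈ S, ∑ σ ∈ S, ∑ μ ∈ Λ.erase ν, if μ = ν + τ - σ then b τ * b σ else 0 := by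
        rw [Finset.sum_comm]
        exact Finset.sum_congr rfl fun τ _ => Finset.sum_comm
    _ ≤ ∑ τ ∈ S, ∑ σ ∈ S, (b τ * b σ - if τ = σ then b τ * b σ else 0) := by
        refine Finset.sum_le_sum fun τ hτ => Finset.sum_le_sum fun σ hσ => ?_
        have h0 := mul_nonneg (hb τ hτ) (hb σ hσ)
        rw [Finset.sum_ite_eq']
        by_cases h : τ = σ
        · simp [h]
        · rw [if_neg h, sub_zero]
          split_ifs
          · exact le_rfl
          · exact h0
    _ = _ := by
        simp only [Finset.sum_sub_distrib, ← Finset.sum_mul_sum, Finset.sum_ite_eq]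
        rw [sq]
        congr 1
        exact Finset.sum_congr rfl fun τ hτ => by rw [if_pos hτ, sq]

lemma enorm2Z_nonneg (d : ℕ) (ν : Fin d → ℤ) : 0 ≤ enorm2Z d ν :=
  Finset.sum_nonneg fun _ _ => sq_nonneg _

lemma one_le_enorm2Z (d : ℕ) {ν : Fin d → ℤ} (h : ν ≠ 0) : 1 ≤ enorm2Z d ν := by
  obtain ⟨j, hj⟩ := Function.ne_iff.mp h
  have h1 : (1 : ℤ) ≤ ν j ^ 2 := Int.add_one_le_iff.mpr (sq_pos_of_ne_zero hj)
  have h2 : (1 : ℝ) ≤ (ν j : ℝ) ^ 2 := by exact_mod_cast h1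
  exact h2.trans (Finset.single_le_sum (f := fun j => ((ν j : ℝ)) ^ 2)
    (fun _ _ => sq_nonneg _) (Finset.mem_univ j))

lemma abs_dotZR_add_le (d : ℕ) (ν τ : Fin d → ℤ) :
    |dotZR d ν (τ + ν)| ≤ enorm2Z d ν * (1 + √(enorm2Z d τ)) := by
  have h1 : dotZR d ν (τ + ν) = dotZR d ν τ + enorm2Z d ν := by
    simp only [dotZR, enorm2Z, ← Finset.sum_add_distrib]
    refine Finset.sum_congr rfl fun j _ => ?_
    simp only [Pi.add_apply]
    push_cast
    ring
  have h2 : |dotZR d ν τ| ≤ √(enorm2Z d ν) * √(enorm2Z d τ) := by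
    rw [← Real.sqrt_mul (enorm2Z_nonneg d ν)]
    exact Real.abs_le_sqrt (Finset.sum_mul_sq_le_sq_mul_sq _ _ _)
  have h3 : √(enorm2Z d ν) ≤ enorm2Z d ν := by
    by_cases h : ν = 0
    · simp [h, enorm2Z]
    · have := one_le_enorm2Z d h
      exact (Real.sqrt_le_left (by linarith)).mpr (by nlinarith)
  calc |dotZR d ν (τ + ν)| ≤ |dotZR d ν τ| + |enorm2Z d ν| := h1 ▸ abs_add_le _ _
    _ ≤ enorm2Z d ν * √(enorm2Z d τ) + enorm2Z d ν := by
      rw [abs_of_nonneg (enorm2Z_nonneg d ν)]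
      gcongr
      exact h2.trans (by gcongr)
    _ = _ := by ring

lemma opCoeff_zero (d : ℕ) (α : (Fin d → ℤ) → ℂ) {a₀ ρ : ℝ} (ha₀ : 0 < a₀) (hρ : 0 < ρ)
    (hα : α 0 = a₀) (ν : Fin d → ℤ) :
    opCoeff d α ρ (1 / (4 * Real.pi ^ 2 * enorm2Z d ν + ρ / a₀)) ν 0 = a₀ := by
  have h0 := enorm2Z_nonneg d ν
  have hpos : 0 < 4 * Real.pi ^ 2 * enorm2Z d ν + ρ / a₀ := by positivity
  have h1 : dotZR d ν (0 + ν) = enorm2Z d ν := by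
    simp [dotZR, enorm2Z, sq]
  have h2 : 1 / (4 * Real.pi ^ 2 * enorm2Z d ν + ρ / a₀) *
      (4 * Real.pi ^ 2 * a₀ * enorm2Z d ν + ρ) = a₀ := by
    rw [one_div, inv_mul_eq_iff_eq_mul₀ hpos.ne']
    field_simp
  rw [opCoeff, h1, hα, if_pos rfl]
  exact_mod_cast h2

lemma norm_opCoeff_le (d : ℕ) (α : (Fin d → ℤ) → ℂ) {a₀ ρ : ℝ} (ha₀ : 0 < a₀) (hρ : 0 < ρ)
    (ν : Fin d → ℤ) {τ : Fin d → ℤ} (hτ : τ ≠ 0) :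
    ‖opCoeff d α ρ (1 / (4 * Real.pi ^ 2 * enorm2Z d ν + ρ / a₀)) ν τ‖ ≤
      ‖α τ‖ * (1 + √(enorm2Z d τ)) := by
  have h0 := enorm2Z_nonneg d ν
  have hpos : 0 < 4 * Real.pi ^ 2 * enorm2Z d ν + ρ / a₀ := by positivity
  rw [opCoeff, if_neg hτ, add_zero]
  simp only [norm_mul, norm_pow, Complex.norm_real, Real.norm_eq_abs, abs_of_pos Real.pi_pos,
    abs_of_pos (one_div_pos.mpr hpos), Complex.norm_ofNat]
  rw [one_div, inv_mul_le_iff₀ hpos]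
  have hle := abs_dotZR_add_le d ν τ
  calc 4 * Real.pi ^ 2 * ‖α τ‖ * |dotZR d ν (τ + ν)|
      ≤ 4 * Real.pi ^ 2 * ‖α τ‖ * (enorm2Z d ν * (1 + √(enorm2Z d τ))) := by gcongr
    _ = 4 * Real.pi ^ 2 * enorm2Z d ν * (‖α τ‖ * (1 + √(enorm2Z d τ))) := by ring
    _ ≤ _ := by
      gcongr
      exact le_add_of_nonneg_right (by positivity)

lemma sum_norm_mul_le (d : ℕ) (T : Finset (Fin d → ℤ)) (hT0 : (0 : Fin d → ℤ) ∉ T)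
    (α : (Fin d → ℤ) → ℂ) :
    ∑ τ ∈ T, ‖α τ‖ * (1 + √(enorm2Z d τ)) ≤
      √(T.card) * √(∑ τ ∈ T, (1 + 4 * Real.pi ^ 2 * enorm2Z d τ) * ‖α τ‖ ^ 2) := by
  rw [← Real.sqrt_mul (Nat.cast_nonneg _)]
  refine Real.le_sqrt_of_sq_le (sq_sum_le_card_mul_sum_sq.trans ?_)
  gcongr with τ hτ
  have h1 := one_le_enorm2Z d (ne_of_mem_of_not_mem hτ hT0)
  have h2 : (1 + √(enorm2Z d τ)) ^ 2 ≤ 1 + 4 * Real.pi ^ 2 * enorm2Z d τ := by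
    have h3 : 1 ≤ √(enorm2Z d τ) := Real.one_le_sqrt.mpr h1
    have h4 := Real.sq_sqrt (enorm2Z_nonneg d τ)
    have h5 : (1 : ℝ) ≤ Real.pi ^ 2 := by nlinarith [Real.pi_gt_three]
    nlinarith
  rw [mul_pow, mul_comm]
  gcongr

theorem stmt5 (d : ℕ) (hd : 1 ≤ d)
    (T : Finset (Fin d → ℤ)) (hT0 : (0 : Fin d → ℤ) ∉ T) (hTsym : ∀ τ ∈ T, -τ ∈ T)
    (a₀ ρ : ℝ) (ha₀ : 0 < a₀) (hρ : 0 < ρ)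
    (aC : (Fin d → ℤ) → ℂ) (haSym : ∀ τ ∈ T, aC (-τ) = (starRingEnd ℂ) (aC τ))
    (a : (Fin d → ℝ) → ℂ) (ha : a = fun x => (a₀ : ℂ) + ∑ τ ∈ T, aC τ * fourF d τ x)
    (r : (Fin d → ℤ) → ℝ)
    (hr : r = fun ν => 1 / (4 * Real.pi ^ 2 * enorm2Z d ν + ρ / a₀))
    (Ψ : (Fin d → ℤ) → (Fin d → ℝ) → ℂ)
    (hΨ : Ψ = fun ν x => (r ν : ℂ) * fourF d ν x)
    (β : ℝ)
    (hβ : β = Real.sqrt T.card *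
      Real.sqrt ((a₀ ^ 2 + ∑ τ ∈ T, (1 + 4 * Real.pi ^ 2 * enorm2Z d τ) * ‖aC τ‖ ^ 2) - a₀ ^ 2)) :
    ∀ (Λ : Finset (Fin d → ℤ)) (ν : Fin d → ℤ), ν ∈ Λ → ν ≠ 0 →
      ∑ μ ∈ Λ.erase ν, ‖GramM d a ρ Ψ ν μ‖ ≤
        (2 * a₀ + ρ / (2 * Real.pi ^ 2)) * β + β ^ 2 := by
  intro Λ ν _ _
  set S := insert 0 T with hS
  set α : (Fin d → ℤ) → ℂ := fun τ => if τ = 0 then (a₀ : ℂ) else aC τ with hα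
  have hα0 : α 0 = a₀ := if_pos rfl
  have hαT : ∀ τ ∈ T, α τ = aC τ := fun τ hτ => if_neg (ne_of_mem_of_not_mem hτ hT0)
  have ha' : a = fun x => ∑ τ ∈ S, α τ * fourF d τ x := by
    rw [ha]
    funext x
    rw [hS, Finset.sum_insert hT0, hα0, fourF_zero, mul_one]
    congr 1
    exact Finset.sum_congr rfl fun τ hτ => by rw [hαT τ hτ]
  have hG : ∀ μ, GramM d a ρ Ψ ν μ = ∑ τ ∈ S, ∑ σ ∈ S, if μ = ν + τ - σ then
      opCoeff d α ρ (r ν) ν τ * (starRingEnd ℂ) (opCoeff d α ρ (r μ) μ σ) else 0 := by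
    intro μ
    rw [← integral_sum_fourF_mul_conj, GramM, ha', hΨ]
    simp only [Lop_fourF d S (Finset.mem_insert_self 0 T)]
  set b : (Fin d → ℤ) → ℝ := fun τ =>
    if τ = 0 then a₀ else ‖aC τ‖ * (1 + √(enorm2Z d τ)) with hb
  have hb0 : ∀ τ, 0 ≤ b τ := by
    intro τ
    simp only [hb]
    split_ifs <;> positivity
  have hcb : ∀ μ τ, ‖opCoeff d α ρ (r μ) μ τ‖ ≤ b τ := by
    intro μ τ
    rw [hr]
    by_cases h : τ = 0
    · subst h
      simp only [opCoeff_zero d α ha₀ hρ hα0, hb, if_true]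
      simp [abs_of_pos ha₀]
    · simpa only [hb, hα, if_neg h] using norm_opCoeff_le d α ha₀ hρ μ h
  have hmain := sum_offDiag_norm_le S Λ
    (fun μ τ σ => opCoeff d α ρ (r ν) ν τ * (starRingEnd ℂ) (opCoeff d α ρ (r μ) μ σ)) b ν
    (fun τ _ => hb0 τ) (fun μ τ _ σ _ => by
      rw [norm_mul, RCLike.norm_conj]
      exact mul_le_mul (hcb ν τ) (hcb μ σ) (norm_nonneg _) (hb0 τ))
  simp only [hG]
  refine hmain.trans ?_
  have hbz : b 0 = a₀ := if_pos rfl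
  have hbT : ∑ τ ∈ T, b τ ≤ β := by
    rw [hβ, add_sub_cancel_left]
    refine le_of_eq_of_le (Finset.sum_congr rfl fun τ hτ => ?_) (sum_norm_mul_le d T hT0 aC)
    exact if_neg (ne_of_mem_of_not_mem hτ hT0)
  have hB0 : 0 ≤ ∑ τ ∈ T, b τ := Finset.sum_nonneg fun τ _ => hb0 τ
  have hsq : 0 ≤ ∑ τ ∈ T, b τ ^ 2 := Finset.sum_nonneg fun τ _ => sq_nonneg _
  rw [hS, Finset.sum_insert hT0, Finset.sum_insert hT0, hbz]
  have hρβ : 0 ≤ ρ / (2 * Real.pi ^ 2) * β := mul_nonneg (by positivity) (hB0.trans hbT)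
  nlinarith [mul_le_mul_of_nonneg_left hbT ha₀.le]
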